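/- arXiv:2011.03245 — 3 statements merged into one kernel-verified Lean document; each statement's English description precedes it below -/
import Mathlib

section
/- Let A be a complex C*-algebra and let a, b ∈ A be nonzero. Then the one-sided Gateaux derivative lim_{t→0⁺} (‖a + t·b‖ − ‖a‖)/t exists and equals (1/‖a‖) · max{ Re ψ(a* b) : ψ is a state on A with ψ(a* a) = ‖a‖² }, where in particular the maximum is attained. -/
open Filter ComplexOrder

theorem aux_norm {A : Type*} [CStarAlgebra A] [Nontrivial A] (y : A) :
    ‖(2:ℝ) • (star y * y) - (‖y‖^2) • (1:A)‖ ≤ ‖y‖^2 := by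
  have hsa : IsSelfAdjoint (star y * y) := IsSelfAdjoint.star_mul_self y
  have e : (2:ℝ) • (star y * y) - (‖y‖^2) • (1:A)
      = cfc (fun x : ℝ => 2 * x - ‖y‖^2) (star y * y) := by
    rw [cfc_sub (fun x : ℝ => 2 * x) (fun _ => ‖y‖^2) _, cfc_const_mul 2 (fun x : ℝ => x) _,
      cfc_id' ℝ _, cfc_const _ _, Algebra.algebraMap_eq_smul_one]
  rw [e]
  refine norm_cfc_le (by positivity) fun x hx => ?_
  have h0 : 0 ≤ x := spectrum_star_mul_self_nonneg x hx
  have h1 : ‖x‖ ≤ ‖star y * y‖ := spectrum.norm_le_norm_of_mem hx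
  rw [CStarRing.norm_star_mul_self, Real.norm_eq_abs, abs_of_nonneg h0] at h1
  rw [Real.norm_eq_abs, abs_le]
  constructor <;> nlinarith

theorem aux_real {A : Type*} [CStarAlgebra A] [Nontrivial A] (f : A →L[ℂ] ℂ) (hf : ‖f‖ ≤ 1)
    (h1 : f 1 = 1) (h : A) (hh : IsSelfAdjoint h) : (f h).im = 0 := by
  have key : ∀ s : ℝ, ((f h).im + s)^2 ≤ ‖h‖^2 + s^2 := by
    intro s
    have n1 : ‖h + (s * Complex.I : ℂ) • (1:A)‖^2 ≤ ‖h‖^2 + s^2 := by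
      rw [pow_two ‖h + _‖, ← CStarRing.norm_star_mul_self]
      have : star (h + (s * Complex.I : ℂ) • (1:A)) * (h + (s * Complex.I : ℂ) • (1:A))
          = h * h + ((s:ℂ)^2) • (1:A) := by
        have e : star (s * Complex.I : ℂ) = -(s * Complex.I) := by simp
        rw [star_add, star_smul, star_one, hh.star_eq, e]
        simp only [add_mul, mul_add, smul_mul_assoc, mul_smul_comm, one_mul, mul_one, neg_smul,
          smul_neg, neg_mul, mul_neg, smul_add]
        have : (s * Complex.I : ℂ) * (s * Complex.I) = -(s:ℂ)^2 := by
          rw [mul_mul_mul_comm, Complex.I_mul_I]; ring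
        rw [smul_smul, this]
        simp
      rw [this]
      refine (norm_add_le _ _).trans ?_
      have := norm_mul_le h h
      rw [norm_smul]
      simp
      nlinarith
    have n2 : ‖f (h + (s * Complex.I : ℂ) • (1:A))‖ ≤ ‖h + (s * Complex.I : ℂ) • (1:A)‖ := by
      simpa using f.le_of_opNorm_le hf (h + (s * Complex.I : ℂ) • (1:A))
    have n3 : |(f h).im + s| ≤ ‖f (h + (s * Complex.I : ℂ) • (1:A))‖ := by
      convert Complex.abs_im_le_norm _ using 2
      simp [h1]
    calc ((f h).im + s)^2 = |(f h).im + s|^2 := (sq_abs _).symm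
      _ ≤ ‖h + (s * Complex.I : ℂ) • (1:A)‖^2 := by
        gcongr; exact n3.trans n2
      _ ≤ _ := n1
  by_contra hne
  have := key ((‖h‖^2 + 1) / (f h).im)
  have e : (f h).im * ((‖h‖^2 + 1) / (f h).im) = ‖h‖^2 + 1 := by field_simp
  nlinarith [sq_nonneg (f h).im, sq_nonneg ‖h‖]

theorem aux_state {A : Type*} [CStarAlgebra A] [Nontrivial A] (f : A →L[ℂ] ℂ) (hf : ‖f‖ ≤ 1)
    (x : A) (hx : x ≠ 0) (hfx : f (star x * x) = ((‖x‖^2 : ℝ) : ℂ)) :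
    ‖f‖ = 1 ∧ f 1 = 1 ∧ ∀ y : A, 0 ≤ f (star y * y) := by
  have hle : ∀ y, ‖f y‖ ≤ ‖y‖ := fun y => by simpa using f.le_of_opNorm_le hf y
  have hre : ∀ y : A, |2 * (f (star y * y)).re - ‖y‖^2 * (f 1).re| ≤ ‖y‖^2 := by
    intro y
    have := (Complex.abs_re_le_norm _).trans ((hle _).trans (aux_norm y))
    rw [map_sub] at this
    rw [← Complex.coe_smul (2:ℝ), ← Complex.coe_smul (‖y‖^2), map_smul, map_smul] at this
    simpa [← Complex.ofReal_pow, Complex.re_ofReal_mul] using this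
  have hpos : 0 < ‖x‖^2 := by positivity
  have h1n : ‖f 1‖ ≤ 1 := by simpa using hle 1
  have h1re : (f 1).re = 1 := by
    apply le_antisymm ((Complex.re_le_norm _).trans h1n)
    have := (abs_le.1 (hre x)).2
    rw [hfx, Complex.ofReal_re] at this
    nlinarith
  have h1 : f 1 = 1 := by
    apply Complex.ext
    · simpa using h1re
    · have : Complex.normSq (f 1) ≤ 1 := by
        rw [Complex.normSq_eq_norm_sq]; nlinarith [norm_nonneg (f 1)]
      rw [Complex.normSq_apply, h1re] at this
      simp
      nlinarith
  refine ⟨le_antisymm hf ?_, h1, fun y => ?_⟩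
  · have := f.le_opNorm 1
    simpa [h1] using this
  · rw [Complex.nonneg_iff]
    refine ⟨?_, (aux_real f hf h1 _ (IsSelfAdjoint.star_mul_self y)).symm⟩
    have := (abs_le.1 (hre y)).1
    rw [h1re] at this
    linarith

theorem aux_deriv {A : Type*} [NormedAddCommGroup A] [NormedSpace ℝ A] (a b : A) :
    ∃ d : ℝ, Tendsto (fun t : ℝ => (‖a + t • b‖ - ‖a‖) / t) (nhdsWithin 0 (Set.Ioi 0)) (nhds d) := by
  have hc : ConvexOn ℝ Set.univ (fun t : ℝ => ‖a + t • b‖) := by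
    refine ⟨convex_univ, fun x _ y _ p q hp hq hpq => ?_⟩
    have : a + (p • x + q • y) • b = p • (a + x • b) + q • (a + y • b) := by
      have : a = (p + q) • a := by rw [hpq, one_smul]
      conv_lhs => rw [this]
      simp only [smul_eq_mul]
      module
    simp only [this]
    refine (norm_add_le _ _).trans ?_
    rw [norm_smul, norm_smul, Real.norm_of_nonneg hp, Real.norm_of_nonneg hq, smul_eq_mul, smul_eq_mul]
  have := hc.hasDerivWithinAt_rightDeriv_of_mem_interior (x := 0) (by simp)
  rw [hasDerivWithinAt_iff_tendsto_slope' (by simp)] at this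
  refine ⟨_, this.congr fun t => ?_⟩
  simp [slope_def_field]

theorem aux_main {A : Type*} [CStarAlgebra A]
    (a b : A) (ha : a ≠ 0) :
    ∃ m : ℝ,
      IsGreatest
        {x : ℝ | ∃ ψ : A →L[ℂ] ℂ, ‖ψ‖ = 1 ∧ (∀ y : A, 0 ≤ ψ (star y * y)) ∧
          ψ (star a * a) = ((‖a‖ ^ 2 : ℝ) : ℂ) ∧ x = (ψ (star a * b)).re} m ∧
      Tendsto (fun t : ℝ => (‖a + t • b‖ - ‖a‖) / t)
        (nhdsWithin 0 (Set.Ioi 0)) (nhds ((1 / ‖a‖) * m)) := by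
  have : Nontrivial A := ⟨a, 0, ha⟩
  have hN : 0 < ‖a‖ := norm_pos_iff.2 ha
  obtain ⟨d, hd⟩ := aux_deriv a b
  have lower : ∀ ψ : A →L[ℂ] ℂ, ‖ψ‖ = 1 → ψ (star a * a) = ((‖a‖ ^ 2 : ℝ) : ℂ) →
      (ψ (star a * b)).re ≤ ‖a‖ * d := by
    intro ψ h1 h2
    refine ge_of_tendsto (hd.const_mul ‖a‖) ?_
    filter_upwards [self_mem_nhdsWithin] with t ht
    have ht : 0 < t := ht
    rw [← mul_div_assoc, le_div_iff₀ ht]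
    have e1 : ‖ψ (star a * (a + t • b))‖ ≤ ‖a‖ * ‖a + t • b‖ := by
      have := ψ.le_opNorm (star a * (a + t • b))
      rw [h1, one_mul] at this
      exact this.trans ((norm_mul_le _ _).trans (by rw [norm_star]))
    have e2 : (ψ (star a * (a + t • b))).re = ‖a‖^2 + t * (ψ (star a * b)).re := by
      rw [mul_add, map_add, h2, mul_smul_comm, ← Complex.coe_smul, map_smul]
      simp [← Complex.ofReal_pow]
    have e3 := Complex.re_le_norm (ψ (star a * (a + t • b)))
    nlinarith
  -- norming functionals
  have hex : ∀ t : ℝ, ∃ f : WeakDual ℂ A, ‖WeakDual.toStrongDual f‖ ≤ 1 ∧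
      f (star (a + t • b) * (a + t • b)) = ((‖a + t • b‖ ^ 2 : ℝ) : ℂ) := by
    intro t
    obtain ⟨g, hg1, hg2⟩ := exists_dual_vector'' ℂ (star (a + t • b) * (a + t • b))
    refine ⟨StrongDual.toWeakDual g, by simpa using hg1, ?_⟩
    rw [CStarRing.norm_star_mul_self, ← pow_two] at hg2
    simpa using hg2
  choose F hF1 hF2 using hex
  let U : Ultrafilter ℝ := Ultrafilter.of (nhdsWithin 0 (Set.Ioi 0))
  have hU : (U : Filter ℝ) ≤ nhdsWithin 0 (Set.Ioi 0) := Ultrafilter.of_le _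
  have hcomp := WeakDual.isCompact_closedBall (𝕜 := ℂ) (E := A) 0 1
  obtain ⟨f, hf, hlim⟩ := hcomp.ultrafilter_le_nhds (U.map F) (by
    rw [le_principal_iff]
    exact Filter.Eventually.of_forall (f := (U : Filter ℝ)) (fun t => by simpa using hF1 t))
  have hpt : ∀ y : A, Tendsto (fun t => F t y) U (nhds (f y)) := by
    intro y
    exact ((WeakDual.eval_continuous y).tendsto f).comp hlim
  have hf' : ‖WeakDual.toStrongDual f‖ ≤ 1 := by simpa using hf
  have hcont : Tendsto (fun t : ℝ => a + t • b) U (nhds a) := by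
    have : Continuous (fun t : ℝ => a + t • b) := by fun_prop
    have := this.tendsto 0
    simp only [zero_smul, add_zero] at this
    exact this.mono_left (hU.trans nhdsWithin_le_nhds)
  have hid : Tendsto (fun t : ℝ => t) U (nhds 0) := hU.trans nhdsWithin_le_nhds
  have hle : ∀ t y, ‖F t y‖ ≤ ‖y‖ := fun t y => by
    simpa using (WeakDual.toStrongDual (F t)).le_of_opNorm_le (hF1 t) y
  have hfa : f (star a * a) = ((‖a‖ ^ 2 : ℝ) : ℂ) := by
    refine tendsto_nhds_unique (hpt _) ?_
    have t1 : Tendsto (fun t : ℝ => ((‖a + t • b‖ ^ 2 : ℝ) : ℂ)) U (nhds ((‖a‖ ^ 2 : ℝ) : ℂ)) :=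
      Tendsto.comp (y := nhds (‖a‖ ^ 2 : ℝ)) (Complex.continuous_ofReal.tendsto _) (hcont.norm.pow 2)
    have t2 : Tendsto (fun t : ℝ => F t (star (a + t • b) * (a + t • b) - star a * a)) U
        (nhds 0) := by
      refine squeeze_zero_norm (fun t => hle t _) ?_
      have := ((hcont.star.mul hcont).sub_const (star a * a)).norm
      simpa using this
    have t3 := t1.sub t2
    rw [sub_zero] at t3
    refine t3.congr fun t => ?_
    rw [map_sub, hF2 t]
    ring
  obtain ⟨hs1, hs2, hs3⟩ := aux_state (WeakDual.toStrongDual f) hf' a ha hfa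
  have hsym : (f (star b * a)).re = (f (star a * b)).re := by
    have := aux_real (WeakDual.toStrongDual f) hf' hs2
      (Complex.I • (star a * b - star b * a)) (by
        rw [IsSelfAdjoint, star_smul, star_sub, star_mul, star_mul, star_star, star_star]
        rw [← starRingEnd_apply, Complex.conj_I, neg_smul, ← smul_neg, neg_sub])
    rw [map_smul, map_sub] at this
    simp only [smul_eq_mul, Complex.I_mul_im, Complex.sub_re] at this
    exact (sub_eq_zero.1 this).symm
  have upper : d * (‖a‖ + ‖a‖) ≤ (f (star a * b + star b * a)).re + 0 * ‖b‖^2 := by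
    have L := (hd.mono_left hU).mul (hcont.norm.add_const ‖a‖)
    have R := ((Complex.continuous_re.tendsto _).comp (hpt (star a * b + star b * a))).add
      (hid.mul_const (‖b‖^2))
    refine le_of_tendsto_of_tendsto L R ?_
    filter_upwards [hU self_mem_nhdsWithin] with t ht
    have ht : 0 < t := ht
    simp only [Function.comp]
    rw [div_mul_eq_mul_div, div_le_iff₀ ht]
    have e : (star (a + t • b) * (a + t • b)) =
        star a * a + (t : ℂ) • (star a * b + star b * a) + ((t^2 : ℝ) : ℂ) • (star b * b) := by
      rw [Complex.coe_smul, Complex.coe_smul, star_add, star_smul, star_trivial t]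
      simp only [add_mul, mul_add, smul_mul_assoc, mul_smul_comm, smul_add, pow_two, mul_smul]
      abel
    have h2 := congrArg Complex.re (hF2 t)
    rw [e, map_add, map_add, map_smul, map_smul, Complex.ofReal_re, Complex.add_re,
      Complex.add_re, smul_eq_mul, smul_eq_mul, Complex.re_ofReal_mul, Complex.re_ofReal_mul] at h2
    have i1 : (F t (star a * a)).re ≤ ‖a‖ * ‖a‖ :=
      (Complex.re_le_norm _).trans ((hle t _).trans CStarRing.norm_star_mul_self.le)
    have i2 : (F t (star b * b)).re ≤ ‖b‖ * ‖b‖ :=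
      (Complex.re_le_norm _).trans ((hle t _).trans CStarRing.norm_star_mul_self.le)
    have i3 := mul_le_mul_of_nonneg_left i2 (sq_nonneg t)
    nlinarith
  rw [map_add, Complex.add_re, hsym] at upper
  have low := lower (WeakDual.toStrongDual f) hs1 hfa
  refine ⟨‖a‖ * d, ⟨⟨WeakDual.toStrongDual f, hs1, hs3, hfa, ?_⟩, ?_⟩, ?_⟩
  · refine le_antisymm ?_ low
    change _ ≤ (f (star a * b)).re
    linarith
  · rintro x ⟨ψ, h1, -, h2, rfl⟩
    exact lower ψ h1 h2
  · rwa [one_div, inv_mul_cancel_left₀ hN.ne']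

/-- **Gateaux derivative of the C*-norm.**
For nonzero `a b` in a complex C*-algebra `A`, the one-sided Gateaux derivative
`lim_{t→0⁺} (‖a + t b‖ - ‖a‖)/t` exists and equals
`(1/‖a‖) · max { Re ψ(a* b) : ψ a state on A with ψ(a* a) = ‖a‖² }`,
the maximum being attained. -/
theorem gateaux_derivative_cstar_norm
    {A : Type*} [NormedRing A] [StarRing A] [CStarRing A]
    [NormedAlgebra ℂ A] [StarModule ℂ A] [CompleteSpace A]
    (a b : A) (ha : a ≠ 0) (hb : b ≠ 0) :
    ∃ m : ℝ,
      IsGreatest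
        {x : ℝ | ∃ ψ : A →L[ℂ] ℂ, ‖ψ‖ = 1 ∧ (∀ y : A, 0 ≤ ψ (star y * y)) ∧
          ψ (star a * a) = ((‖a‖ ^ 2 : ℝ) : ℂ) ∧ x = (ψ (star a * b)).re} m ∧
      Tendsto (fun t : ℝ => (‖a + t • b‖ - ‖a‖) / t)
        (nhdsWithin 0 (Set.Ioi 0)) (nhds ((1 / ‖a‖) * m)) := by
  letI : CStarAlgebra A := CStarAlgebra.mk
  exact aux_main a b ha
end

section
/- Let A be a complex C*-algebra and let I be a closed two-sided ideal of A. Let a ∈ A be nonzero with dist(a, I) < ‖a‖. Then for any nonzero b ∈ A, lim_{t→0⁺} (‖a + t·b‖ − ‖a‖)/t = (1/‖a‖) · max{ Re ψ(a* b) : ψ is a state on A whose restriction to I has norm one and ψ(a* a) = ‖a‖² }. -/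
open Filter ComplexOrder

theorem aux_norm_two_sub {A : Type*} [CStarAlgebra A] (y : A) (hy : ‖y‖ ≤ 1) :
    ‖(2 : ℂ) • (star y * y) - 1‖ ≤ 1 := by
  let _ := CStarAlgebra.spectralOrder A
  have _ := CStarAlgebra.spectralOrderedRing A
  set c := star y * y with hc
  have hcsa : star c = c := by simp [hc]
  have h1 : y * star y ≤ 1 := by
    rw [← CStarAlgebra.norm_le_one_iff_of_nonneg _ (mul_star_self_nonneg y),
      CStarRing.norm_self_mul_star]
    nlinarith [norm_nonneg y]
  have h2 : 0 ≤ c - c * c := by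
    have := star_left_conjugate_nonneg (sub_nonneg.mpr h1) y
    have e : c - c * c = star y * (1 - y * star y) * y := by rw [hc]; noncomm_ring
    rw [e]; exact this
  set d := (2 : ℂ) • c - 1 with hd
  have hds : star d = d := by simp [hd, hcsa]
  have hdd : star d * d ≤ 1 := by
    rw [hds, ← sub_nonneg]
    have e : 1 - d * d = (c - c * c) + (c - c * c) + ((c - c * c) + (c - c * c)) := by
      rw [hd, two_smul]; noncomm_ring
    rw [e]
    positivity
  rw [← CStarAlgebra.norm_le_one_iff_of_nonneg _ (star_mul_self_nonneg d),
      CStarRing.norm_star_mul_self] at hdd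
  nlinarith [norm_nonneg d]

section aux
variable {A : Type*} [NormedRing A] [StarRing A] [CStarRing A]
    [NormedAlgebra ℂ A] [StarModule ℂ A] [CompleteSpace A]

theorem aux_norm_two_sub' (y : A) (hy : ‖y‖ ≤ 1) :
    ‖(2 : ℂ) • (star y * y) - 1‖ ≤ 1 := by
  let _ : CStarAlgebra A := {}
  exact aux_norm_two_sub y hy

theorem aux_le (ψ : A →L[ℂ] ℂ) (h : ‖ψ‖ ≤ 1) (x : A) : ‖ψ x‖ ≤ ‖x‖ := by
  simpa using ψ.le_of_opNorm_le h x

theorem aux_one (ψ : A →L[ℂ] ℂ) (h : ‖ψ‖ ≤ 1) (y : A) (hy : ‖y‖ ≤ 1)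
    (h1 : ψ (star y * y) = 1) : ψ 1 = 1 := by
  have : Nontrivial A := by
    by_contra hn
    rw [not_nontrivial_iff_subsingleton] at hn
    rw [Subsingleton.elim (star y * y) 0] at h1
    simp at h1
  have a1 := (aux_le ψ h _).trans (aux_norm_two_sub' y hy)
  have a2 := aux_le ψ h 1
  rw [CStarRing.norm_one] at a2
  rw [map_sub, map_smul, h1] at a1
  have a3 := (Complex.abs_re_le_norm _).trans a1
  simp at a3
  have a4 := (abs_le.mp a3).2
  have a5 : ‖ψ 1‖ ^ 2 ≤ 1 := by nlinarith [norm_nonneg (ψ 1)]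
  rw [Complex.sq_norm, Complex.normSq_apply] at a5
  have a6 : (ψ 1).im = 0 := by
    have : (ψ 1).im * (ψ 1).im ≤ 0 := by nlinarith
    nlinarith [mul_self_eq_zero.mp (le_antisymm this (mul_self_nonneg _))]
  rw [a6] at a5
  apply Complex.ext
  · simp; nlinarith
  · simpa using a6

theorem aux_real_s1 (ψ : A →L[ℂ] ℂ) (h : ‖ψ‖ ≤ 1) (h1 : ψ 1 = 1) (x : A) (hx : star x = x) :
    (ψ x).im = 0 := by
  have : Nontrivial A := by
    by_contra hn
    rw [not_nontrivial_iff_subsingleton] at hn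
    rw [Subsingleton.elim (1 : A) 0] at h1
    simp at h1
  have key : ∀ s : ℝ, ((ψ x).im + s) ^ 2 ≤ ‖x‖ ^ 2 + s ^ 2 := by
    intro s
    set z := x + (s * Complex.I) • (1 : A) with hz
    have e : star z * z = x * x + ((s : ℂ) ^ 2) • (1 : A) := by
      simp only [hz, star_add, hx, star_smul, star_one]
      simp only [add_mul, mul_add, smul_mul_assoc, mul_smul_comm, one_mul, mul_one, smul_smul]
      have : star ((s : ℂ) * Complex.I) = - (s * Complex.I) := by simp
      rw [this]
      have h2 : (s * Complex.I) * (s * Complex.I) = -(s : ℂ) ^ 2 := by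
        linear_combination ((s : ℂ) ^ 2) * Complex.I_sq
      simp only [neg_smul, smul_add, smul_neg, smul_smul, h2]
      abel
    have n1 : ‖z‖ * ‖z‖ ≤ ‖x‖ * ‖x‖ + s ^ 2 := by
      rw [← CStarRing.norm_star_mul_self, e]
      refine (norm_add_le _ _).trans (add_le_add (norm_mul_le _ _) ?_)
      rw [norm_smul, CStarRing.norm_one]; simp
    have n2 := aux_le ψ h z
    have n3 := (Complex.abs_im_le_norm _).trans n2
    have e2 : (ψ z).im = (ψ x).im + s := by simp [hz, h1]
    rw [e2] at n3
    have := sq_le_sq' (by linarith [(abs_le.mp n3).1]) ((abs_le.mp n3).2)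
    nlinarith
  by_contra hne
  have := key ((‖x‖ ^ 2 + 1) / (2 * (ψ x).im))
  have e : 2 * (ψ x).im * ((‖x‖ ^ 2 + 1) / (2 * (ψ x).im)) = ‖x‖ ^ 2 + 1 := by
    field_simp
  nlinarith [sq_nonneg (ψ x).im]

theorem aux_pos (ψ : A →L[ℂ] ℂ) (h : ‖ψ‖ ≤ 1) (h1 : ψ 1 = 1) (y : A) :
    0 ≤ ψ (star y * y) := by
  have him := aux_real_s1 ψ h h1 (star y * y) (by simp)
  have hre : 0 ≤ (ψ (star y * y)).re := by
    by_cases hy : y = 0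
    · simp [hy]
    have hn : 0 < ‖y‖ := norm_pos_iff.mpr hy
    set w := ((‖y‖⁻¹ : ℝ) : ℂ) • y with hw
    have hwn : ‖w‖ ≤ 1 := by
      rw [hw, norm_smul]; simp [hn.ne']
    have := (Complex.abs_re_le_norm _).trans ((aux_le ψ h _).trans (aux_norm_two_sub' w hwn))
    have e : star w * w = ((‖y‖⁻¹ ^ 2 : ℝ) : ℂ) • (star y * y) := by
      simp [hw, smul_smul, sq]
    rw [e, map_sub, map_smul, map_smul, h1] at this
    have := (abs_le.mp this).1
    simp only [smul_eq_mul, Complex.sub_re, Complex.one_re, ← Complex.ofReal_ofNat,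
      Complex.re_ofReal_mul] at this
    have h3 : 0 ≤ ‖y‖⁻¹ ^ 2 * (ψ (star y * y)).re := by linarith
    exact nonneg_of_mul_nonneg_right h3 (by positivity)
  rw [Complex.le_def]
  exact ⟨by simpa using hre, by simpa using him.symm⟩

theorem aux_ideal (I : Submodule ℂ A)
    (hI_left : ∀ x ∈ I, ∀ y : A, y * x ∈ I)
    (hI_right : ∀ x ∈ I, ∀ y : A, x * y ∈ I)
    (ψ : A →L[ℂ] ℂ) (h : ‖ψ‖ ≤ 1) (h1 : ψ 1 = 1) (c d : A) (hc : star c = c) (hcn : ‖c‖ ≤ 1)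
    (hψ : ψ c = 1) (hd : ‖d‖ < 1) (hcd : c - d ∈ I) : ‖ψ.comp I.subtypeL‖ = 1 := by
  have hp : ∀ k : ℕ, ψ (c ^ 2 ^ k) = 1 ∧ ‖c ^ 2 ^ k‖ ≤ 1 ∧ star (c ^ 2 ^ k) = c ^ 2 ^ k := by
    intro k
    induction k with
    | zero => simpa using ⟨hψ, hcn, hc⟩
    | succ k ih =>
      obtain ⟨i1, i2, i3⟩ := ih
      rw [pow_succ, pow_mul]
      set e := c ^ 2 ^ k
      have n : ‖e ^ 2‖ ≤ 1 := by
        rw [sq]; exact (norm_mul_le _ _).trans (by nlinarith [norm_nonneg e])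
      refine ⟨?_, n, by simp [i3]⟩
      have p := aux_pos ψ h h1 (e - 1)
      have ee : star (e - 1) * (e - 1) = e ^ 2 - e - e + 1 := by
        simp [i3]; noncomm_ring
      rw [ee] at p
      simp only [map_add, map_sub, i1, h1] at p
      rw [Complex.le_def] at p
      have q := (Complex.abs_re_le_norm _).trans ((aux_le ψ h _).trans n)
      have q2 := (abs_le.mp q).2
      simp at p
      apply Complex.ext
      · simp; linarith [p.1]
      · simpa using p.2.symm
  have hj : ∀ n : ℕ, c ^ n - d ^ n ∈ I := by
    intro n
    induction n with
    | zero => simp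
    | succ n ih =>
      have : c ^ (n + 1) - d ^ (n + 1) = (c ^ n - d ^ n) * c + d ^ n * (c - d) := by
        simp only [pow_succ]; noncomm_ring
      rw [this]
      exact I.add_mem (hI_right _ ih _) (hI_left _ hcd _)
  apply le_antisymm
  · refine (ψ.comp I.subtypeL).opNorm_le_bound zero_le_one fun x => ?_
    simpa using aux_le ψ h (x : A)
  · set N := ‖ψ.comp I.subtypeL‖
    have hN : 0 ≤ N := ContinuousLinearMap.opNorm_nonneg _
    have key : ∀ k : ℕ, 1 - ‖d‖ ^ 2 ^ k ≤ N * (1 + ‖d‖ ^ 2 ^ k) := by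
      intro k
      obtain ⟨i1, i2, i3⟩ := hp k
      have dn : ‖d ^ 2 ^ k‖ ≤ ‖d‖ ^ 2 ^ k := norm_pow_le' _ (by positivity)
      have l := (ψ.comp I.subtypeL).le_opNorm ⟨_, hj (2 ^ k)⟩
      have l2 : ‖ψ (c ^ 2 ^ k - d ^ 2 ^ k)‖ ≤ N * ‖c ^ 2 ^ k - d ^ 2 ^ k‖ := l
      rw [map_sub, i1] at l2
      have l3 : 1 - ‖ψ (d ^ 2 ^ k)‖ ≤ ‖1 - ψ (d ^ 2 ^ k)‖ := by
        simpa using norm_sub_norm_le (1 : ℂ) (ψ (d ^ 2 ^ k))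
      have l4 := aux_le ψ h (d ^ 2 ^ k)
      have l5 : N * ‖c ^ 2 ^ k - d ^ 2 ^ k‖ ≤ N * (1 + ‖d‖ ^ 2 ^ k) :=
        mul_le_mul_of_nonneg_left ((norm_sub_le _ _).trans (by linarith)) hN
      linarith
    have t0 : Tendsto (fun k : ℕ => ‖d‖ ^ 2 ^ k) atTop (nhds 0) :=
      (tendsto_pow_atTop_nhds_zero_of_lt_one (norm_nonneg d) hd).comp
        (tendsto_pow_atTop_atTop_of_one_lt (one_lt_two : (1 : ℕ) < 2))
    have := le_of_tendsto_of_tendsto' (t0.const_sub 1) ((t0.const_add 1).const_mul N) key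
    simpa using this

theorem aux_lim (a b : A) : ∃ D : ℝ, Tendsto (fun t : ℝ => (‖a + t • b‖ - ‖a‖) / t)
        (nhdsWithin 0 (Set.Ioi 0)) (nhds D) := by
  have hc : ConvexOn ℝ Set.univ (fun t : ℝ => ‖a + t • b‖) := by
    refine ⟨convex_univ, fun x _ y _ p q hp hq hpq => ?_⟩
    have : a + (p • x + q • y) • b = p • (a + x • b) + q • (a + y • b) := by
      rw [smul_add, smul_add, add_add_add_comm, ← add_smul, hpq, one_smul, add_smul, smul_smul,
        smul_smul]
      rfl
    dsimp only
    rw [this]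
    refine (norm_add_le _ _).trans ?_
    rw [norm_smul, norm_smul, Real.norm_of_nonneg hp, Real.norm_of_nonneg hq]
    rfl
  have := hc.hasDerivWithinAt_rightDeriv_of_mem_interior (x := 0) (by simp)
  rw [hasDerivWithinAt_iff_tendsto_slope' (by simp)] at this
  refine ⟨_, this.congr fun t => ?_⟩
  simp [slope_def_field]

theorem aux_exists (a b : A) (ha : a ≠ 0) (D : ℝ)
    (hD : Tendsto (fun t : ℝ => (‖a + t • b‖ - ‖a‖) / t)
        (nhdsWithin 0 (Set.Ioi 0)) (nhds D)) :
    ∃ ψ : A →L[ℂ] ℂ, ‖ψ‖ ≤ 1 ∧ ψ (star a * a) = ((‖a‖ ^ 2 : ℝ) : ℂ) ∧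
      2 * (‖a‖ * D) ≤ (ψ (star a * b + star b * a)).re := by
  set x : ℝ → A := fun t => star (a + t • b) * (a + t • b) with hx
  have hg : ∀ t : ℝ, ∃ g : StrongDual ℂ A, ‖g‖ ≤ 1 ∧ g (x t) = ‖x t‖ :=
    fun t => exists_dual_vector'' ℂ (x t)
  choose g hg1 hg2 using hg
  let U : Ultrafilter ℝ := Ultrafilter.of (nhdsWithin 0 (Set.Ioi 0))
  have hU : (U : Filter ℝ) ≤ nhdsWithin 0 (Set.Ioi 0) := Ultrafilter.of_le _
  have hU0 : Tendsto (fun t : ℝ => t) U (nhds 0) :=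
    tendsto_id.mono_left (hU.trans nhdsWithin_le_nhds)
  have hUp : ∀ᶠ t in (U : Filter ℝ), 0 < t := hU self_mem_nhdsWithin
  obtain ⟨φ, hφ, hlim⟩ := (WeakDual.isCompact_closedBall (0 : StrongDual ℂ A) 1).ultrafilter_le_nhds
    (U.map fun t => StrongDual.toWeakDual (g t)) (by
      rw [le_principal_iff]
      refine Filter.mem_map.mpr (Filter.univ_mem' fun t => ?_)
      simpa using hg1 t)
  set ψ : StrongDual ℂ A := WeakDual.toStrongDual φ with hψ
  have hψ1 : ‖ψ‖ ≤ 1 := by simpa using hφ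
  have hev : ∀ y : A, Tendsto (fun t => g t y) U (nhds (ψ y)) := by
    intro y
    have : Tendsto (fun t => StrongDual.toWeakDual (g t)) U (nhds φ) := hlim
    exact ((WeakDual.eval_continuous y).tendsto φ).comp this
  set h := star a * b + star b * a with hh
  set k := star b * b with hk
  have hxe : ∀ t : ℝ, x t = star a * a + ((t : ℂ) • h + ((t : ℂ) ^ 2) • k) := by
    intro t
    simp only [hx, hh, hk, ← Complex.coe_smul, star_add, star_smul, add_mul, mul_add,
      smul_mul_assoc, mul_smul_comm, smul_smul, smul_add]
    have : star (t : ℂ) = t := by simp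
    rw [this, ← sq]
    abel
  have hxn : ∀ t, ‖x t‖ = ‖a + t • b‖ ^ 2 := fun t => by
    rw [hx, sq]; exact CStarRing.norm_star_mul_self
  have hgx : ∀ t, g t (star a * a) + (t * g t h + (t : ℂ) ^ 2 * g t k) =
      ((‖a + t • b‖ ^ 2 : ℝ) : ℂ) := by
    intro t
    have := hg2 t
    rw [hxn, hxe] at this
    simpa using this
  have hU0c : Tendsto (fun t : ℝ => (t : ℂ)) U (nhds 0) := by
    simpa [Function.comp_def] using (Complex.continuous_ofReal.tendsto 0).comp hU0
  have hcont : Tendsto (fun t : ℝ => ‖a + t • b‖) U (nhds ‖a‖) := by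
    have : Continuous (fun t : ℝ => ‖a + t • b‖) := by fun_prop
    simpa [Function.comp_def] using (this.tendsto 0).comp hU0
  refine ⟨ψ, hψ1, ?_, ?_⟩
  · have l1 : Tendsto (fun t : ℝ => g t (star a * a) + (t * g t h + (t : ℂ) ^ 2 * g t k)) U
        (nhds (ψ (star a * a) + (0 * ψ h + 0 ^ 2 * ψ k))) :=
      (hev _).add ((hU0c.mul (hev h)).add ((hU0c.pow 2).mul (hev k)))
    have l2 : Tendsto (fun t : ℝ => ((‖a + t • b‖ ^ 2 : ℝ) : ℂ)) U
        (nhds ((‖a‖ ^ 2 : ℝ) : ℂ)) :=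
      (Complex.continuous_ofReal.tendsto _).comp (hcont.pow 2)
    have := tendsto_nhds_unique (l1.congr hgx) l2
    simpa using this
  · have l1 : Tendsto (fun t : ℝ => (g t h + t * g t k).re) U (nhds (ψ h + 0 * ψ k).re) :=
      (Complex.continuous_re.tendsto _).comp ((hev h).add (hU0c.mul (hev k)))
    have l2 : Tendsto (fun t : ℝ => (‖a + t • b‖ + ‖a‖) * ((‖a + t • b‖ - ‖a‖) / t)) U
        (nhds ((‖a‖ + ‖a‖) * D)) := (hcont.add_const _).mul (hD.mono_left hU)
    have : (‖a‖ + ‖a‖) * D ≤ (ψ h + 0 * ψ k).re := by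
      refine le_of_tendsto_of_tendsto l2 l1 ?_
      filter_upwards [hUp] with t ht
      have e := congrArg Complex.re (hgx t)
      have e2 : (g t (star a * a)).re + t * (g t h + t * g t k).re = ‖a + t • b‖ ^ 2 := by
        rw [← Complex.re_ofReal_mul, ← Complex.add_re, ← Complex.ofReal_re (‖a + t • b‖ ^ 2), ← e]
        congr 1; ring
      have e3 : (g t (star a * a)).re ≤ ‖a‖ ^ 2 := by
        have := (Complex.re_le_norm _).trans (aux_le (g t) (hg1 t) (star a * a))
        rwa [CStarRing.norm_star_mul_self, ← sq] at this
      rw [← mul_div_assoc, div_le_iff₀ ht]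
      nlinarith
    simp only [zero_mul, add_zero] at this
    linarith

end aux

/-- Let `I` be a closed two-sided ideal of a complex C*-algebra `A` and let `a ≠ 0`
satisfy `dist(a, I) < ‖a‖`.  Then for any `b ≠ 0`,
`lim_{t→0⁺} (‖a + t b‖ - ‖a‖)/t = (1/‖a‖) · max { Re ψ(a* b) }`, where the maximum
runs over states `ψ` on `A` whose restriction to `I` has norm one and which satisfy
`ψ(a* a) = ‖a‖²`. -/
theorem gateaux_derivative_cstar_norm_ideal
    {A : Type*} [NormedRing A] [StarRing A] [CStarRing A]
    [NormedAlgebra ℂ A] [StarModule ℂ A] [CompleteSpace A]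
    (I : Submodule ℂ A) (hI_closed : IsClosed (I : Set A))
    (hI_left : ∀ x ∈ I, ∀ y : A, y * x ∈ I)
    (hI_right : ∀ x ∈ I, ∀ y : A, x * y ∈ I)
    (a b : A) (ha : a ≠ 0) (hb : b ≠ 0)
    (hdist : Metric.infDist a (I : Set A) < ‖a‖) :
    ∃ m : ℝ,
      IsGreatest
        {x : ℝ | ∃ ψ : A →L[ℂ] ℂ, ‖ψ‖ = 1 ∧ (∀ y : A, 0 ≤ ψ (star y * y)) ∧
          ‖ψ.comp I.subtypeL‖ = 1 ∧
          ψ (star a * a) = ((‖a‖ ^ 2 : ℝ) : ℂ) ∧ x = (ψ (star a * b)).re} m ∧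
      Tendsto (fun t : ℝ => (‖a + t • b‖ - ‖a‖) / t)
        (nhdsWithin 0 (Set.Ioi 0)) (nhds ((1 / ‖a‖) * m)) := by
  have hapos : 0 < ‖a‖ := norm_pos_iff.mpr ha
  obtain ⟨D, hD⟩ := aux_lim a b
  refine ⟨‖a‖ * D, ?_, by rwa [← mul_assoc, one_div, inv_mul_cancel₀ hapos.ne', one_mul]⟩
  have upper : ∀ ψ : A →L[ℂ] ℂ, ‖ψ‖ = 1 → ψ (star a * a) = ((‖a‖ ^ 2 : ℝ) : ℂ) →
      (ψ (star a * b)).re ≤ ‖a‖ * D := by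
    intro ψ h1 h2
    refine ge_of_tendsto (hD.const_mul ‖a‖) ?_
    filter_upwards [self_mem_nhdsWithin] with t ht
    have ht : 0 < t := ht
    have l := (Complex.re_le_norm _).trans (aux_le ψ h1.le (star a * (a + t • b)))
    have l2 : ‖star a * (a + t • b)‖ ≤ ‖a‖ * ‖a + t • b‖ := by
      simpa using norm_mul_le (star a) (a + t • b)
    have e : (ψ (star a * (a + t • b))).re = ‖a‖ ^ 2 + t * (ψ (star a * b)).re := by
      rw [← Complex.coe_smul, mul_add, map_add, h2, mul_smul_comm, map_smul, smul_eq_mul,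
        Complex.add_re, Complex.re_ofReal_mul, Complex.ofReal_re]
    rw [← mul_div_assoc, le_div_iff₀ ht]
    nlinarith
  refine ⟨?_, ?_⟩
  · obtain ⟨ψ, hψ, hψa, hψb⟩ := aux_exists a b ha D hD
    set r : ℂ := ((‖a‖⁻¹ : ℝ) : ℂ) with hr
    have hrn : ‖r‖ = ‖a‖⁻¹ := by simp [hr]
    have hrs : star r = r := by simp [hr]
    have hrr : r * r * ((‖a‖ ^ 2 : ℝ) : ℂ) = 1 := by
      rw [hr, ← Complex.ofReal_mul, ← Complex.ofReal_mul, ← Complex.ofReal_one]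
      congr 1; field_simp
    set y := r • a with hy
    have hyn : ‖y‖ = 1 := by rw [hy, norm_smul, hrn, inv_mul_cancel₀ hapos.ne']
    have hyy : star y * y = (r * r) • (star a * a) := by
      simp only [hy, star_smul, hrs, smul_mul_assoc, mul_smul_comm, smul_smul]
    have hψy : ψ (star y * y) = 1 := by
      rw [hyy, map_smul, hψa, smul_eq_mul, hrr]
    have h1 := aux_one ψ hψ y hyn.le hψy
    have hyc : ‖star y * y‖ = 1 := by rw [CStarRing.norm_star_mul_self, hyn, one_mul]
    have hψn : ‖ψ‖ = 1 := by
      refine le_antisymm hψ ?_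
      have := ψ.le_opNorm (star y * y)
      rwa [hψy, hyc, mul_one, norm_one] at this
    obtain ⟨i, hi, hdi⟩ := (Metric.infDist_lt_iff ⟨0, I.zero_mem⟩).mp hdist
    rw [dist_eq_norm] at hdi
    have hid : ‖ψ.comp I.subtypeL‖ = 1 := by
      refine aux_ideal I hI_left hI_right ψ hψ h1 (star y * y) (star y * (r • (a - i)))
        (by simp) hyc.le hψy ?_ ?_
      · refine (norm_mul_le _ _).trans_lt ?_
        rw [norm_star, hyn, one_mul, norm_smul, hrn, inv_mul_lt_iff₀ hapos, mul_one]
        exact hdi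
      · rw [← mul_sub, hy, ← smul_sub, sub_sub_cancel]
        exact hI_left _ (I.smul_mem _ hi) _
    have hpos := aux_pos ψ hψ h1
    refine ⟨ψ, hψn, hpos, hid, hψa, le_antisymm ?_ (upper ψ hψn hψa)⟩
    -- the real parts of `ψ (a* b)` and `ψ (b* a)` agree
    have him := aux_real_s1 ψ hψ h1 (Complex.I • (star a * b - star b * a)) (by
      simp only [star_smul, star_sub, star_mul, star_star]
      rw [show star Complex.I = -Complex.I by simp, neg_smul, ← smul_neg, neg_sub])
    simp at him
    simp only [map_add, Complex.add_re] at hψb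
    linarith
  · rintro _ ⟨ψ, h1, -, -, h2, rfl⟩
    exact upper ψ h1 h2
end

section
/- Let A be a complex C*-algebra, let I be a closed two-sided ideal of A, and let a ∈ A satisfy dist(a, I) < ‖a‖. Let B be a linear subspace of A. Then a is Birkhoff–James orthogonal to B if and only if there exists a state ψ on A whose restriction to I has norm one, such that ψ(a* a) = ‖a‖² and ψ(a* b) = 0 for all b ∈ B. -/
open ComplexOrder

section helpers

variable {A : Type*} [NormedRing A] [StarRing A] [CStarRing A]
    [NormedAlgebra ℂ A] [StarModule ℂ A] [CompleteSpace A]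

/-- Norm estimate: `‖u + t (1 - u u*) x‖² ≤ 1 + K t²`. -/
lemma key_norm (u x : A) (hu : ‖u‖ ≤ 1) :
    ∃ K : ℝ, 0 ≤ K ∧ ∀ t : ℝ,
      ‖u + (t : ℂ) • ((1 - u * star u) * x)‖ ^ 2 ≤ 1 + K * t ^ 2 := by
  letI : CStarAlgebra A := {}
  letI := CStarAlgebra.spectralOrder A
  haveI := CStarAlgebra.spectralOrderedRing A
  set h : A := 1 - u * star u with hh
  have hsa : star h = h := by simp [hh]
  set y : A := x * star u with hy
  set k : A := star y * y + h * x * star (h * x) with hk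
  refine ⟨‖k‖, norm_nonneg _, fun t => ?_⟩
  set z : A := u + (t : ℂ) • (h * x) with hz
  have hk0 : 0 ≤ k := add_nonneg (star_mul_self_nonneg _) (mul_star_self_nonneg _)
  have hk1 : k ≤ algebraMap ℝ A ‖k‖ := IsSelfAdjoint.le_algebraMap_norm_self hk0.isSelfAdjoint
  have h1 : star u * u ≤ 1 := by
    have := (CStarAlgebra.norm_le_one_iff_of_nonneg (star u * u) (star_mul_self_nonneg u)).1
    apply this
    rw [CStarRing.norm_star_mul_self]
    nlinarith [norm_nonneg u]
  have h2 : 0 ≤ u * (1 - star u * u) * star u := star_right_conjugate_nonneg (sub_nonneg.2 h1) u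
  have h3 : 0 ≤ star (h - (t : ℂ) • y) * (h - (t : ℂ) • y) := star_mul_self_nonneg _
  have h4 : 0 ≤ (t ^ 2 : ℝ) • (algebraMap ℝ A ‖k‖ - k) :=
    smul_nonneg (sq_nonneg t) (sub_nonneg.2 hk1)
  have hle : z * star z ≤ algebraMap ℝ A (1 + ‖k‖ * t ^ 2) := by
    rw [← sub_nonneg]
    convert add_nonneg (add_nonneg h2 h3) h4 using 1
    have e1 : (t ^ 2 : ℝ) • (algebraMap ℝ A ‖k‖ - k)
        = algebraMap ℝ A (‖k‖ * t ^ 2) - (t : ℂ) • (t : ℂ) • k := by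
      rw [smul_sub, Algebra.algebraMap_eq_smul_one, Algebra.algebraMap_eq_smul_one, smul_smul,
        mul_comm, smul_smul, ← pow_two]
      congr 1
      rw [← Complex.ofReal_pow]; rfl
    have e2 : u * (1 - star u * u) * star u = h - h * h := by
      rw [hh]; noncomm_ring
    rw [e1, e2, map_add, map_one, hz, hk]
    have e3 : u * star u = 1 - h := by rw [hh]; abel
    have e4 : star ((t : ℂ)) = t := Complex.conj_ofReal t
    simp only [star_add, star_sub, star_smul, e4, hsa, add_mul, mul_add, sub_mul, mul_sub,
      smul_mul_assoc, mul_smul_comm, smul_add, smul_sub, e3, star_mul, hy, star_star, mul_assoc]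
    abel
  rw [pow_two, ← CStarRing.norm_self_mul_star]
  refine (CStarAlgebra.norm_le_iff_le_algebraMap _ (by positivity)
    (mul_star_self_nonneg z)).2 hle

lemma key_re (f : A →L[ℂ] ℂ) (hf : ‖f‖ ≤ 1) (u x : A) (hu : ‖u‖ ≤ 1) (hfu : f u = 1) :
    (f ((1 - u * star u) * x)).re ≤ 0 := by
  obtain ⟨K, hK, hbd⟩ := key_norm u x hu
  set r := (f ((1 - u * star u) * x)).re with hr
  by_contra! hpos
  have main : ∀ t : ℝ, 0 < t → 2 * r ≤ K * t := by
    intro t ht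
    have h1 := hbd t
    set z := u + (t : ℂ) • ((1 - u * star u) * x) with hz
    have h2 : (f z).re = 1 + t * r := by
      rw [hz, map_add, map_smul, hfu]; simp [hr]
    have h3 : 1 + t * r ≤ ‖z‖ := by
      rw [← h2]
      refine (Complex.re_le_norm _).trans ((f.le_opNorm z).trans ?_)
      nlinarith [norm_nonneg z]
    have h4 : (1 + t * r) ^ 2 ≤ 1 + K * t ^ 2 :=
      (pow_le_pow_left₀ (by positivity) h3 2).trans h1
    have h5 : t * (2 * r) ≤ t * (K * t) := by nlinarith [sq_nonneg (t * r)]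
    exact le_of_mul_le_mul_left h5 ht
  have h6 := main (r / (K + 1)) (by positivity)
  have h7 : K * (r / (K + 1)) ≤ r := by
    rw [mul_div_assoc', div_le_iff₀ (by positivity)]; nlinarith
  linarith

lemma key_zero (f : A →L[ℂ] ℂ) (hf : ‖f‖ ≤ 1) (u x : A) (hu : ‖u‖ ≤ 1) (hfu : f u = 1) :
    f (u * star u * x) = f x := by
  have key := fun x => key_re f hf u x hu hfu
  have e : f ((1 - u * star u) * x) = 0 := by
    have h1 := key x
    have h2 := key (-x)
    have h3 := key (Complex.I • x)
    have h4 := key (-(Complex.I • x))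
    simp only [mul_neg, mul_smul_comm, map_neg, map_smul, smul_eq_mul, Complex.neg_re,
      Complex.mul_re, Complex.I_re, Complex.I_im] at h1 h2 h3 h4
    apply Complex.ext <;> simp only [Complex.zero_re, Complex.zero_im] <;> linarith
  rw [sub_mul, one_mul, map_sub, sub_eq_zero] at e
  exact e.symm

/-- A contractive unital functional is positive. -/
lemma pos_of_unital [Nontrivial A] (φ : A →L[ℂ] ℂ) (hφ : ‖φ‖ ≤ 1) (h1 : φ 1 = 1) (y : A) :
    0 ≤ φ (star y * y) := by
  letI : CStarAlgebra A := {}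
  letI := CStarAlgebra.spectralOrder A
  haveI := CStarAlgebra.spectralOrderedRing A
  have hb : ∀ x, ‖φ x‖ ≤ ‖x‖ := fun x => by
    refine (φ.le_opNorm x).trans ?_
    nlinarith [norm_nonneg x]
  set p := star y * y with hp
  have hp0 : 0 ≤ p := star_mul_self_nonneg y
  have hsa : star p = p := hp0.isSelfAdjoint
  have him : (φ p).im = 0 := by
    have main : ∀ t : ℝ, 2 * t * (φ p).im ≤ ‖p‖ ^ 2 := by
      intro t
      have e4 : star ((t : ℂ)) = t := Complex.conj_ofReal t
      have eI : star Complex.I = -Complex.I := Complex.conj_I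
      have a1 := hb (p + ((t : ℂ) * Complex.I) • (1 : A))
      have a2 : ‖p + ((t : ℂ) * Complex.I) • (1 : A)‖ ^ 2 ≤ ‖p‖ ^ 2 + t ^ 2 := by
        rw [pow_two, ← CStarRing.norm_star_mul_self]
        have : star (p + ((t : ℂ) * Complex.I) • (1 : A)) * (p + ((t : ℂ) * Complex.I) • (1 : A))
            = p * p + ((t ^ 2 : ℝ) : ℂ) • (1 : A) := by
          have e5 : ((t ^ 2 : ℝ) : ℂ) = -(((t : ℂ) * Complex.I) * ((t : ℂ) * Complex.I)) := by
            push_cast; ring_nf; simp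
          rw [e5]
          simp only [star_add, star_smul, star_mul', e4, eI, hsa, star_one, add_mul, mul_add,
            smul_mul_assoc, mul_smul_comm, one_mul, mul_one, mul_neg, neg_smul, neg_mul, smul_add, smul_neg, mul_smul]
          abel
        rw [this]
        refine (norm_add_le _ _).trans ?_
        rw [norm_smul, CStarRing.norm_one, Complex.norm_real, mul_one, Real.norm_eq_abs,
          abs_of_nonneg (sq_nonneg t), pow_two ‖p‖]
        gcongr
        exact norm_mul_le _ _
      have a3 : |(φ (p + ((t : ℂ) * Complex.I) • (1 : A))).im| ≤ _ := Complex.abs_im_le_norm _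
      have a4 : (φ (p + ((t : ℂ) * Complex.I) • (1 : A))).im = (φ p).im + t := by
        rw [map_add, map_smul, h1]; simp
      rw [a4] at a3
      have a5 := pow_le_pow_left₀ (abs_nonneg _) (a3.trans a1) 2
      rw [sq_abs] at a5
      nlinarith [sq_nonneg (φ p).im]
    by_contra hne
    have := main ((‖p‖ ^ 2 + 1) / (2 * (φ p).im))
    have e : 2 * ((‖p‖ ^ 2 + 1) / (2 * (φ p).im)) * (φ p).im = ‖p‖ ^ 2 + 1 := by
      field_simp
    linarith
  have hre : 0 ≤ (φ p).re := by
    have a1 : ‖algebraMap ℝ A ‖p‖ - p‖ ≤ ‖p‖ := by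
      refine (CStarAlgebra.norm_le_iff_le_algebraMap _ (norm_nonneg _)
        (sub_nonneg.2 (IsSelfAdjoint.le_algebraMap_norm_self hp0.isSelfAdjoint))).2 ?_
      exact sub_le_self _ hp0
    have a2 := (Complex.re_le_norm _).trans ((hb _).trans a1)
    have a3 : algebraMap ℝ A ‖p‖ = ((‖p‖ : ℝ) : ℂ) • (1 : A) := by
      rw [Algebra.algebraMap_eq_smul_one]; rfl
    rw [map_sub, a3, map_smul, h1] at a2
    simp at a2
    exact a2
  rw [Complex.nonneg_iff]
  exact ⟨hre, him.symm⟩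

/-- Hahn-Banach. -/
lemma hahn (a : A) (B : Submodule ℂ A) (hB : ∀ b ∈ B, ‖a‖ ≤ ‖a + b‖) :
    ∃ f : A →L[ℂ] ℂ, ‖f‖ ≤ 1 ∧ f a = (‖a‖ : ℂ) ∧ ∀ b ∈ B, f b = 0 := by
  set C := B.topologicalClosure with hC
  haveI : IsClosed (C : Set A) := B.isClosed_topologicalClosure
  obtain ⟨g, hg, hga⟩ := exists_dual_vector'' ℂ (C.mkQ a : A ⧸ C)
  have hmk : ∀ x : A, ‖C.mkQ x‖ ≤ ‖x‖ := fun x => Submodule.Quotient.norm_mk_le C x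
  have hna : ‖(C.mkQ a : A ⧸ C)‖ = ‖a‖ := by
    refine le_antisymm (hmk a) ?_
    have hcl : ∀ b ∈ C, ‖a‖ ≤ ‖a + b‖ := by
      intro b hb
      have hcl : IsClosed {b : A | ‖a‖ ≤ ‖a + b‖} := isClosed_le (by fun_prop) (by fun_prop)
      exact closure_minimal (s := (B : Set A)) hB hcl hb
    refine le_of_forall_pos_le_add fun ε hε => ?_
    obtain ⟨m, hm, hlt⟩ := Submodule.Quotient.norm_mk_lt (S := C) (C.mkQ a) hε
    have : m - a ∈ C := by
      rw [← Submodule.Quotient.eq]; exact hm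
    have := hcl _ this
    rw [add_sub_cancel] at this
    linarith
  refine ⟨LinearMap.mkContinuous (g.toLinearMap.comp C.mkQ) 1 (fun x => ?_), ?_, ?_, ?_⟩
  · refine (g.le_opNorm _).trans ?_
    exact mul_le_mul hg (hmk x) (norm_nonneg _) zero_le_one
  · exact LinearMap.mkContinuous_norm_le _ zero_le_one _
  · change g (C.mkQ a) = _
    rw [hga, hna]; rfl
  · intro b hb
    change g (C.mkQ b) = 0
    have : C.mkQ b = 0 := by
      simpa using B.le_topologicalClosure hb
    rw [this, map_zero]

end helpers

/-- Let `I` be a closed two-sided ideal of a complex C*-algebra `A` and let `a`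
satisfy `dist(a, I) < ‖a‖`.  Then `a` is Birkhoff–James orthogonal to a subspace `B`
if and only if there exists a state `ψ` on `A`, whose restriction to `I` has norm one,
with `ψ(a* a) = ‖a‖²` and `ψ(a* b) = 0` for all `b ∈ B`. -/
theorem birkhoffJames_orthogonal_iff_exists_state
    {A : Type*} [NormedRing A] [StarRing A] [CStarRing A]
    [NormedAlgebra ℂ A] [StarModule ℂ A] [CompleteSpace A]
    (I : Submodule ℂ A) (hI_closed : IsClosed (I : Set A))
    (hI_left : ∀ x ∈ I, ∀ y : A, y * x ∈ I)
    (hI_right : ∀ x ∈ I, ∀ y : A, x * y ∈ I)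
    (a : A) (hdist : Metric.infDist a (I : Set A) < ‖a‖)
    (B : Submodule ℂ A) :
    (∀ b ∈ B, ‖a‖ ≤ ‖a + b‖) ↔
      ∃ ψ : A →L[ℂ] ℂ, ‖ψ‖ = 1 ∧ (∀ y : A, 0 ≤ ψ (star y * y)) ∧
        ‖ψ.comp I.subtypeL‖ = 1 ∧
        ψ (star a * a) = ((‖a‖ ^ 2 : ℝ) : ℂ) ∧
        ∀ b ∈ B, ψ (star a * b) = 0 := by
  have hN : 0 < ‖a‖ := Metric.infDist_nonneg.trans_lt hdist
  constructor
  swap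
  · rintro ⟨ψ, hψ, -, -, haa, hab⟩ b hb
    have e : ψ (star a * (a + b)) = ((‖a‖ ^ 2 : ℝ) : ℂ) := by
      rw [mul_add, map_add, haa, hab b hb, add_zero]
    have h1 := ψ.le_opNorm (star a * (a + b))
    rw [e, hψ, one_mul, Complex.norm_real, Real.norm_eq_abs, abs_of_nonneg (sq_nonneg _)] at h1
    have h2 := h1.trans (norm_mul_le _ _)
    rw [norm_star, pow_two] at h2
    exact le_of_mul_le_mul_left h2 hN
  intro hB
  haveI : Nontrivial A := ⟨a, 0, fun h => by simp [h] at hN⟩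
  obtain ⟨f, hf, hfa, hfB⟩ := hahn a B hB
  set N : ℂ := (‖a‖ : ℂ) with hNdef
  have hN0 : N ≠ 0 := by simpa [hNdef] using hN.ne'
  have hNs : star N = N := Complex.conj_ofReal _
  have hNn : ‖N⁻¹‖ = ‖a‖⁻¹ := by rw [norm_inv, hNdef, Complex.norm_real, norm_norm]
  set u : A := N⁻¹ • a with hu
  have hau : a = N • u := by rw [hu, smul_inv_smul₀ hN0]
  have hun : ‖u‖ ≤ 1 := by
    rw [hu, norm_smul, hNn, inv_mul_cancel₀ hN.ne']
  have hfu : f u = 1 := by rw [hu, map_smul, hfa, smul_eq_mul, inv_mul_cancel₀ hN0]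
  have key := fun x => key_zero f hf u x hun hfu
  set φ : A →L[ℂ] ℂ := f.comp (ContinuousLinearMap.mul ℂ A u) with hφ
  have hφa : ∀ x, φ x = f (u * x) := fun x => rfl
  have hφb : ∀ x, ‖φ x‖ ≤ ‖x‖ := fun x => by
    rw [hφa]
    refine (f.le_opNorm _).trans ?_
    have := norm_mul_le u x
    nlinarith [norm_nonneg x, norm_nonneg (u * x), norm_nonneg f]
  have hφ1 : φ 1 = 1 := by rw [hφa, mul_one, hfu]
  have hφn : ‖φ‖ ≤ 1 := φ.opNorm_le_bound zero_le_one (fun x => by simpa using hφb x)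
  refine ⟨φ, le_antisymm hφn ?_, pos_of_unital φ hφn hφ1, ?_, ?_, ?_⟩
  · have := φ.le_opNorm 1
    have h1 : ‖(1 : A)‖ = 1 := CStarRing.norm_one
    rwa [hφ1, h1, mul_one, norm_one] at this
  · set T := φ.comp I.subtypeL with hT
    have hTa : ∀ x : I, T x = φ x := fun x => rfl
    refine le_antisymm (T.opNorm_le_bound zero_le_one
      (fun x => by rw [hTa, one_mul]; exact hφb x)) ?_
    obtain ⟨i, hi, hai⟩ := (Metric.infDist_lt_iff ⟨0, I.zero_mem⟩).1 hdist
    set r : A := N⁻¹ • (a - i) with hr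
    have hrn : ‖r‖ < 1 := by
      rw [hr, norm_smul, hNn, inv_mul_lt_iff₀ hN, mul_one, ← dist_eq_norm]; exact hai
    set c : A := star u * u with hc
    set d : A := star u * r with hd
    have hcn : ‖c‖ ≤ 1 := by
      rw [hc, CStarRing.norm_star_mul_self]; nlinarith [norm_nonneg u]
    have hdn : ‖d‖ ≤ ‖r‖ := by
      refine (norm_mul_le _ _).trans ?_
      rw [norm_star]; nlinarith [norm_nonneg r]
    have hcd : c - d ∈ I := by
      have : c - d = star u * (N⁻¹ • i) := by
        rw [hc, hd, ← mul_sub, hu, hr, smul_sub, sub_sub_cancel]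
      rw [this]
      exact hI_left _ (I.smul_mem _ hi) _
    have hmem : ∀ n : ℕ, c ^ n - d ^ n ∈ I := by
      intro n
      induction n with
      | zero => simp
      | succ n ih =>
        have : c ^ (n + 1) - d ^ (n + 1) = c ^ n * (c - d) + (c ^ n - d ^ n) * d := by
          rw [pow_succ, pow_succ]; noncomm_ring
        rw [this]
        exact I.add_mem (hI_left _ hcd _) (hI_right _ ih _)
    have hφc : ∀ n : ℕ, φ (c ^ n) = 1 := by
      intro n
      induction n with
      | zero => rw [pow_zero, hφ1]
      | succ n ih =>
        rw [← ih, hφa, hφa, pow_succ', ← key (u * c ^ n)]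
        congr 1
        rw [← mul_assoc, ← mul_assoc, hc, ← mul_assoc]
    haveI : NormOneClass A := ⟨CStarRing.norm_one⟩
    have hest : ∀ n : ℕ, 1 - ‖r‖ ^ n ≤ ‖T‖ * (1 + ‖r‖ ^ n) := by
      intro n
      have hdp : ‖d ^ n‖ ≤ ‖r‖ ^ n :=
        (norm_pow_le d n).trans (pow_le_pow_left₀ (norm_nonneg _) hdn n)
      have hcp : ‖c ^ n‖ ≤ 1 :=
        (norm_pow_le c n).trans (pow_le_one₀ (norm_nonneg _) hcn)
      have h1 := T.le_opNorm ⟨_, hmem n⟩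
      rw [hTa] at h1
      simp only [map_sub, hφc, Submodule.coe_norm] at h1
      have h2 : 1 - ‖r‖ ^ n ≤ ‖1 - φ (d ^ n)‖ := by
        have := norm_sub_norm_le (1 : ℂ) (φ (d ^ n))
        rw [norm_one] at this
        linarith [hφb (d ^ n)]
      refine h2.trans (h1.trans ?_)
      gcongr
      exact (norm_sub_le _ _).trans (add_le_add hcp hdp)
    have hlim := tendsto_pow_atTop_nhds_zero_of_lt_one (norm_nonneg r) hrn
    have hL := hlim.const_sub 1
    have hR := (hlim.const_add 1).const_mul ‖T‖
    have := le_of_tendsto_of_tendsto' hL hR hest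
    simpa using this
  · rw [hφa]
    have : u * (star a * a) = (N * N) • (u * star u * u) := by
      rw [hau, star_smul, hNs]
      simp only [smul_mul_assoc, mul_smul_comm, smul_smul, mul_assoc]
    rw [this, map_smul, key, hfu, hNdef]
    push_cast
    simp [pow_two]
  · intro b hb
    rw [hφa]
    have : u * (star a * b) = N • (u * star u * b) := by
      rw [hau, star_smul, hNs]
      simp only [smul_mul_assoc, mul_smul_comm, mul_assoc]
    rw [this, map_smul, key, hfB b hb, smul_zero]
end
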